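/- Let ν be a finite non-negative Borel measure on ℝ with ν(ℝ) ∈ (0,1], and define α_ν(x) := exp(∫_ℝ log(√(1+t²)/|t−x|) dν(t)) for x ∈ ℝ. Then for every a ∈ supp ν with ν({a}) < 1 and every p ∈ (1, 1/ν({a})), there exists ε > 0 such that ∫_{a−ε}^{a+ε} α_ν(x)^p dx < ∞. -/

import Mathlib

open MeasureTheory Set

theorem lintegral_abs_rpow_neg_lt_top {q M R : ℝ} (hq : q < 1) (hR : 0 ≤ R) :
    ∫⁻ u in Ioo (-R) R, ENNReal.ofReal (M * |u| ^ (-q) + 1) < ⊤ := by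
  have h1 : IntervalIntegrable (fun u : ℝ => |u| ^ (-q)) volume 0 R :=
    (intervalIntegral.intervalIntegrable_rpow' (r := -q) (by linarith)).congr (by
      intro u hu
      rw [uIoc_of_le hR] at hu
      simp only [abs_of_pos hu.1])
  have h2 : IntervalIntegrable (fun u : ℝ => |u| ^ (-q)) volume (-R) 0 := by
    have := (IntervalIntegrable.iff_comp_neg).1 h1
    simpa using this.symm
  have h3 := ((h2.trans h1).const_mul M).add (intervalIntegrable_const (c := (1 : ℝ)))
  rw [intervalIntegrable_iff_integrableOn_Ioo_of_le (by linarith)] at h3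
  exact h3.lintegral_lt_top

theorem lintegral_abs_sub_rpow_neg_le {q M a δ t : ℝ} (ht : t ∈ Icc (a - δ) (a + δ)) :
    ∫⁻ x in Ioo (a - δ / 2) (a + δ / 2), ENNReal.ofReal (M * |t - x| ^ (-q) + 1) ≤
      ∫⁻ u in Ioo (-(2 * δ)) (2 * δ), ENNReal.ofReal (M * |u| ^ (-q) + 1) := by
  rw [← lintegral_indicator measurableSet_Ioo, ← lintegral_indicator measurableSet_Ioo,
    ← lintegral_sub_right_eq_self (indicator (Ioo (-(2 * δ)) (2 * δ)) _) t]
  refine lintegral_mono fun x => indicator_apply_le' (fun hy => ?_) (fun _ => zero_le)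
  rw [indicator_of_mem, abs_sub_comm]
  rw [mem_Icc] at ht
  rw [mem_Ioo] at hy ⊢
  constructor <;> linarith

theorem sqrt_one_add_sq_le (t : ℝ) : √(1 + t ^ 2) ≤ 1 + |t| := by
  rw [Real.sqrt_le_left (by positivity)]
  nlinarith [abs_nonneg t, sq_abs t]

theorem log_sqrt_div_le_of_lt_abs_sub {a δ t x : ℝ} (hδ : 0 < δ) (hx : |x - a| < δ / 2)
    (ht : δ < |t - a|) :
    Real.log (√(1 + t ^ 2) / |t - x|) ≤ Real.log (2 * ((1 + |a|) / δ + 1)) := by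
  have h1 : |t - a| ≤ |t - x| + |x - a| := abs_sub_le _ _ _
  have hpos : 0 < |t - x| := by linarith
  apply Real.log_le_log (by positivity)
  rw [div_le_iff₀ hpos]
  have h2 : |t| ≤ |t - a| + |a| := by simpa using abs_add_le (t - a) a
  have h3 : 1 + |a| ≤ (1 + |a|) / δ * (2 * |t - x|) := by
    rw [div_mul_eq_mul_div, le_div_iff₀ hδ]
    have := abs_nonneg a
    gcongr
    linarith
  linarith [sqrt_one_add_sq_le t]

theorem exp_mul_log_sqrt_div_le {a δ t x q : ℝ} (hq : 0 ≤ q) (ht : |t - a| ≤ δ) :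
    Real.exp (q * Real.log (√(1 + t ^ 2) / |t - x|)) ≤
      (1 + |a| + δ) ^ q * |t - x| ^ (-q) + 1 := by
  have hM : √(1 + t ^ 2) ≤ 1 + |a| + δ := by
    have h2 : |t| ≤ |t - a| + |a| := by simpa using abs_add_le (t - a) a
    linarith [sqrt_one_add_sq_le t]
  have hs : 0 ≤ √(1 + t ^ 2) := Real.sqrt_nonneg _
  rcases eq_or_ne t x with rfl | hne
  · have : 0 ≤ (1 + |a| + δ) ^ q * |t - t| ^ (-q) :=
      mul_nonneg (Real.rpow_nonneg (hs.trans hM) _) (Real.rpow_nonneg (abs_nonneg _) _)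
    simpa using this
  · have hpos : 0 < |t - x| := abs_pos.2 (sub_ne_zero.2 hne)
    rw [mul_comm, ← Real.rpow_def_of_pos (by positivity), Real.div_rpow hs hpos.le,
      Real.rpow_neg hpos.le, ← div_eq_mul_inv]
    have : √(1 + t ^ 2) ^ q / |t - x| ^ q ≤ (1 + |a| + δ) ^ q / |t - x| ^ q := by gcongr
    linarith

theorem exp_mul_setIntegral_le {α : Type*} [MeasurableSpace α] {ν : Measure α}
    [IsFiniteMeasure ν] {B : Set α} (hB : ν B ≠ 0) {f : α → ℝ} (hf : IntegrableOn f B ν)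
    (p : ℝ) :
    ENNReal.ofReal (Real.exp (p * ∫ t in B, f t ∂ν)) ≤
      (ν B)⁻¹ * ∫⁻ t in B, ENNReal.ofReal (Real.exp (p * ν.real B * f t)) ∂ν := by
  have hb : 0 < ν.real B := ENNReal.toReal_pos hB (measure_ne_top _ _)
  by_cases hg : IntegrableOn (fun t => Real.exp (p * ν.real B * f t)) B ν
  · have key := convexOn_exp.map_set_average_le Real.continuous_exp.continuousOn isClosed_univ hB
      (measure_ne_top _ _) (by simp) (hf.const_mul (p * ν.real B)) hg
    rw [setAverage_eq, setAverage_eq, integral_const_mul, smul_eq_mul, smul_eq_mul] at key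
    rw [← ofReal_integral_eq_lintegral_ofReal hg (ae_of_all _ fun _ => (Real.exp_pos _).le),
      ← ofReal_measureReal, ← ENNReal.ofReal_inv_of_pos hb,
      ← ENNReal.ofReal_mul (inv_nonneg.2 hb.le)]
    apply ENNReal.ofReal_le_ofReal
    convert key using 2
    field_simp
  · have : ∫⁻ t in B, ENNReal.ofReal (Real.exp (p * ν.real B * f t)) ∂ν = ⊤ := by
      by_contra h
      refine hg ((lintegral_ofReal_ne_top_iff_integrable ?_ ?_).1 h)
      · exact Real.continuous_exp.comp_aestronglyMeasurable
          (hf.aestronglyMeasurable.const_mul _)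
      · exact ae_of_all _ fun _ => (Real.exp_pos _).le
    rw [this, ENNReal.mul_top (ENNReal.inv_ne_zero.2 (measure_ne_top _ _))]
    exact le_top

theorem stmt_18 (ν : Measure ℝ) [IsFiniteMeasure ν]
    (hν : 0 < ν Set.univ ∧ ν Set.univ ≤ 1)
    (a : ℝ) (ha : ∀ ε > (0 : ℝ), 0 < ν (Set.Ioo (a - ε) (a + ε)))
    (hatom : ν {a} < 1)
    (p : ℝ) (hp : 1 < p) (hpa : (ν {a}).toReal * p < 1) :
    ∃ ε > (0 : ℝ),
      IntegrableOn
        (fun x : ℝ =>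
          Real.exp (∫ t : ℝ, Real.log (Real.sqrt (1 + t ^ 2) / |t - x|) ∂ν) ^ p)
        (Set.Ioo (a - ε) (a + ε)) := by
  have hp0 : 0 < p := by linarith
  obtain ⟨δ, hδq, hδ⟩ : ∃ δ : ℝ, (ν (Icc (a - δ) (a + δ))).toReal * p < 1 ∧ 0 < δ := by
    have h1 := (ENNReal.tendsto_toReal (measure_ne_top ν {a})).comp
      (tendsto_measure_Icc_nhdsWithin_right' ν a)
    exact (((h1.mul_const p).eventually_lt_const hpa).and self_mem_nhdsWithin).exists
  set B := Icc (a - δ) (a + δ) with hBdef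
  have hB : ν B ≠ 0 := ((ha δ hδ).trans_le (measure_mono Ioo_subset_Icc_self)).ne'
  have hmemB : ∀ t, t ∈ B ↔ |t - a| ≤ δ := fun t => by
    rw [abs_le, hBdef, mem_Icc]; constructor <;> rintro ⟨_, _⟩ <;> constructor <;> linarith
  set q := p * ν.real B with hq
  have hq0 : 0 ≤ q := by positivity
  have hq1 : q < 1 := by rw [hq, mul_comm]; exact hδq
  set M := (1 + |a| + δ) ^ q with hM
  set K := p * ∫ t in Bᶜ, Real.log (2 * ((1 + |a|) / δ + 1)) ∂ν with hK
  have hmeas : Measurable fun z : ℝ × ℝ => Real.log (√(1 + z.2 ^ 2) / |z.2 - z.1|) := by fun_prop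
  set F : ℝ → ℝ := fun x => Real.exp (∫ t : ℝ, Real.log (√(1 + t ^ 2) / |t - x|) ∂ν) ^ p with hF
  have hFmeas : Measurable F :=
    ((hmeas.stronglyMeasurable.integral_prod_right').measurable.exp).pow_const p
  have hbound : ∀ x ∈ Ioo (a - δ / 2) (a + δ / 2), ENNReal.ofReal (F x) ≤
      1 + ENNReal.ofReal (Real.exp K) * ((ν B)⁻¹ *
        ∫⁻ t in B, ENNReal.ofReal (M * |t - x| ^ (-q) + 1) ∂ν) := by
    intro x hx
    have hxa : |x - a| < δ / 2 := by
      rw [abs_lt]; constructor <;> linarith [hx.1, hx.2]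
    by_cases hf : Integrable (fun t : ℝ => Real.log (√(1 + t ^ 2) / |t - x|)) ν
    · refine le_trans ?_ le_add_self
      have hFx : F x ≤ Real.exp K *
          Real.exp (p * ∫ t in B, Real.log (√(1 + t ^ 2) / |t - x|) ∂ν) := by
        simp only [hF]
        rw [← Real.exp_mul, ← Real.exp_add, Real.exp_le_exp,
          ← integral_add_compl (s := B) measurableSet_Icc hf]
        have : ∫ t in Bᶜ, Real.log (√(1 + t ^ 2) / |t - x|) ∂ν ≤
            ∫ t in Bᶜ, Real.log (2 * ((1 + |a|) / δ + 1)) ∂ν := by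
          refine setIntegral_mono_on hf.integrableOn (integrable_const _)
            measurableSet_Icc.compl fun t ht => ?_
          rw [mem_compl_iff, hmemB, not_le] at ht
          exact log_sqrt_div_le_of_lt_abs_sub hδ hxa ht
        rw [hK]
        nlinarith
      refine (ENNReal.ofReal_le_ofReal hFx).trans ?_
      rw [ENNReal.ofReal_mul (Real.exp_pos _).le]
      gcongr
      refine (exp_mul_setIntegral_le hB hf.integrableOn p).trans ?_
      refine mul_le_mul_right ?_ _
      refine setLIntegral_mono' measurableSet_Icc fun t ht => ENNReal.ofReal_le_ofReal ?_
      exact exp_mul_log_sqrt_div_le hq0 ((hmemB t).1 ht)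
    · have : F x = 1 := by simp [hF, integral_undef hf]
      rw [this, ENNReal.ofReal_one]
      exact le_self_add
  refine ⟨δ / 2, by positivity, hFmeas.aestronglyMeasurable, ?_⟩
  rw [hasFiniteIntegral_iff_ofReal (ae_of_all _ fun x => Real.rpow_nonneg (Real.exp_pos _).le _)]
  refine (setLIntegral_mono' measurableSet_Ioo hbound).trans_lt ?_
  have hmeas2 : Measurable fun z : ℝ × ℝ => ENNReal.ofReal (M * |z.2 - z.1| ^ (-q) + 1) := by
    fun_prop
  have hmeas3 : Measurable fun x : ℝ =>
      ∫⁻ t in B, ENNReal.ofReal (M * |t - x| ^ (-q) + 1) ∂ν := hmeas2.lintegral_prod_right'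
  rw [lintegral_add_left measurable_const, lintegral_const_mul _ (hmeas3.const_mul _),
    lintegral_const_mul _ hmeas3, lintegral_lintegral_swap hmeas2.aemeasurable]
  refine ENNReal.add_lt_top.2 ⟨by simp, ENNReal.mul_lt_top ENNReal.ofReal_lt_top
    (ENNReal.mul_lt_top (ENNReal.inv_lt_top.2 (pos_iff_ne_zero.2 hB)) ?_)⟩
  refine (setLIntegral_mono' measurableSet_Icc fun t ht =>
    lintegral_abs_sub_rpow_neg_le ht).trans_lt ?_
  rw [setLIntegral_const]
  exact ENNReal.mul_lt_top (lintegral_abs_rpow_neg_lt_top hq1 (by positivity))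
    (measure_lt_top _ _)
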